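/- arXiv:1702.03098 — 2 statements merged into one kernel-verified Lean document; each statement's English description precedes it below -/
import Mathlib

section
/- Let S ⊆ ℝ^n be a measurable set, π : ℝ^n → [0,∞) a measurable function with 0 < π(x) ≤ u for every x ∈ S (where 0 < u < ∞), and q : ℝ^n × ℝ^n → [0,∞) a measurable function satisfying q(x,y) ≥ ε for all x, y ∈ S, where ε > 0. Then for every x ∈ S and every measurable set A ⊆ S, the Metropolis–Hastings acceptance integral satisfies ∫_A q(x,y) · min(1, π(y)q(y,x)/(π(x)q(x,y))) dy ≥ (ε/u) · ∫_A π(y) dy, where both integrals are with respect to Lebesgue measure on ℝ^n. (This is the minorization inequality P(x,A) ≥ (ε/u)π(A) proved for the Metropolis–Hastings kernel in Theorem 1 of the paper.) -/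
open MeasureTheory

/-- The pointwise bound behind the minorization inequality: here `a = π x`, `b = π y`,
`c = q x y` and `d = q y x`. -/
theorem mul_le_mul_min_one_mh_ratio {u ε a b c d : ℝ} (hε : 0 < ε) (ha : 0 < a) (hau : a ≤ u)
    (hb : 0 < b) (hbu : b ≤ u) (hc : ε ≤ c) (hd : ε ≤ d) :
    ε / u * b ≤ c * min 1 (b * d / (a * c)) := by
  have hc0 : 0 < c := hε.trans_le hc
  have hu : 0 < u := ha.trans_le hau
  have hratio : c * (b * d / (a * c)) = d / a * b := by field_simp
  rw [mul_min_of_nonneg _ _ hc0.le, mul_one, hratio]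
  refine le_min ?_ ?_
  · calc ε / u * b ≤ ε / u * u := by gcongr
      _ = ε := div_mul_cancel₀ ε hu.ne'
      _ ≤ c := hc
  · gcongr
    exact hε.le.trans hd

/-- Minorization inequality for the Metropolis–Hastings kernel:
for a target density `π` bounded above by `u` and positive on `S`, and a proposal
density bounded below by `ε > 0` on `S × S`, the acceptance integral over any
measurable `A ⊆ S` is at least `(ε/u) ⬝ ∫_A π`. -/
theorem mh_minorization
    {n : ℕ} (S : Set (Fin n → ℝ)) (hS : MeasurableSet S)
    (π : (Fin n → ℝ) → ℝ) (hπmeas : Measurable π)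
    (u : ℝ) (hu : 0 < u)
    (hπ : ∀ x ∈ S, 0 < π x ∧ π x ≤ u)
    (q : (Fin n → ℝ) → (Fin n → ℝ) → ℝ)
    (hqmeas : Measurable (Function.uncurry q))
    (hqnonneg : ∀ x y, 0 ≤ q x y)
    (ε : ℝ) (hε : 0 < ε)
    (hq : ∀ x ∈ S, ∀ y ∈ S, ε ≤ q x y) :
    ∀ x ∈ S, ∀ A : Set (Fin n → ℝ), MeasurableSet A → A ⊆ S →
      ENNReal.ofReal (ε / u) * (∫⁻ y in A, ENNReal.ofReal (π y)) ≤
        ∫⁻ y in A,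
          ENNReal.ofReal (q x y * min 1 (π y * q y x / (π x * q x y))) := by
  intro x hx A hA hAS
  rw [← lintegral_const_mul _ hπmeas.ennreal_ofReal]
  refine setLIntegral_mono' hA fun y hy => ?_
  have hyS := hAS hy
  rw [← ENNReal.ofReal_mul (div_pos hε hu).le]
  exact ENNReal.ofReal_le_ofReal <|
    mul_le_mul_min_one_mh_ratio hε (hπ x hx).1 (hπ x hx).2 (hπ y hyS).1 (hπ y hyS).2
      (hq x hx y hyS) (hq y hyS x hx)
end

section
/- Let d ≥ 2, v ∈ ℝ, ν > 0, and let A be a symmetric positive definite real d×d matrix with blocks A₁ (upper-left (d−1)×(d−1)), A₂ ∈ ℝ^{d−1} (entries A_{j,d}, j < d), and A₃ = A_{d,d}. Set V := A₁ − A₂1ᵀ − 1A₂ᵀ + A₃·11ᵀ, w := v·V⁻¹(A₃·1 − A₂), and D := v²A₃ − wᵀVw, and assume ν + D > 0. Then for every x ∈ ℝ^{d−1}, writing y := (x₁,…,x_{d−1}, v − (x₁+⋯+x_{d−1})), one has (1 + (yᵀAy)/ν)^{−(ν+d)/2} = ((ν+D)/ν)^{−(ν+d)/2} · (1 + ((x−w)ᵀV(x−w))/(ν+D))^{−(ν+d)/2}.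 In particular, up to a positive constant factor, x ↦ (1 + (yᵀAy)/ν)^{−(ν+d)/2} is the density kernel of a (d−1)-dimensional Pearson type VII (elliptical) distribution with location w, positive definite scale matrix V⁻¹, and density generator g(t) = (1 + t/(ν+D))^{−(ν+d)/2}. -/
open Matrix
open scoped BigOperators

theorem dotProduct_mulVec_hyperplane {m : ℕ} {A : Matrix (Fin (m + 1)) (Fin (m + 1)) ℝ}
    (hA : A.IsSymm) {V : Matrix (Fin m) (Fin m) ℝ} {b : Fin m → ℝ}
    (hV : ∀ i j, V i j = A i.castSucc j.castSucc - A i.castSucc (Fin.last m) -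
      A j.castSucc (Fin.last m) + A (Fin.last m) (Fin.last m))
    (hb : ∀ j, b j = A (Fin.last m) (Fin.last m) - A j.castSucc (Fin.last m))
    (v : ℝ) (x : Fin m → ℝ) :
    (Fin.snoc x (v - ∑ j, x j) : Fin (m + 1) → ℝ) ⬝ᵥ A *ᵥ Fin.snoc x (v - ∑ j, x j) =
      x ⬝ᵥ V *ᵥ x - 2 * v * (x ⬝ᵥ b) + v ^ 2 * A (Fin.last m) (Fin.last m) := by
  have hlast : ∀ j : Fin m, A (Fin.last m) j.castSucc = A j.castSucc (Fin.last m) :=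
    fun j => hA.apply _ _
  set c : Fin m → ℝ := fun j => A j.castSucc (Fin.last m) with hc
  set a := A (Fin.last m) (Fin.last m)
  set s := ∑ j, x j with hs
  have hcx : ∑ j, c j * x j = x ⬝ᵥ c := by simp only [dotProduct, mul_comm]
  have hbx : x ⬝ᵥ b = a * s - x ⬝ᵥ c := by
    simp only [dotProduct, hb, mul_sub, Finset.sum_sub_distrib, hs, Finset.mul_sum, hc, mul_comm]
  have hVx : ∀ i, (V *ᵥ x) i =
      (∑ j, A i.castSucc j.castSucc * x j) - c i * s - x ⬝ᵥ c + a * s := by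
    intro i
    rw [← hcx, hs]
    simp only [mulVec, dotProduct, hV, sub_mul, add_mul, Finset.sum_sub_distrib,
      Finset.sum_add_distrib, Finset.mul_sum, hc]
  have hxVx : x ⬝ᵥ V *ᵥ x = (∑ i, x i * ∑ j, A i.castSucc j.castSucc * x j) -
      2 * s * (x ⬝ᵥ c) + a * s ^ 2 := by
    have h : x ⬝ᵥ V *ᵥ x = ∑ i, (x i * (∑ j, A i.castSucc j.castSucc * x j) -
        x i * c i * s - x i * (x ⬝ᵥ c) + x i * (a * s)) :=
      Finset.sum_congr rfl fun i _ => by rw [hVx]; ring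
    rw [h, Finset.sum_add_distrib, Finset.sum_sub_distrib, Finset.sum_sub_distrib,
      ← Finset.sum_mul, ← Finset.sum_mul, ← Finset.sum_mul, ← hs,
      show ∑ i, x i * c i = x ⬝ᵥ c from rfl]
    ring
  rw [hxVx, hbx]
  simp only [dotProduct, mulVec, Fin.sum_univ_castSucc, Fin.snoc_castSucc, Fin.snoc_last, hlast,
    mul_add, Finset.sum_add_distrib]
  have h : ∑ i, x i * (A i.castSucc (Fin.last m) * (v - s)) = (∑ i, x i * c i) * (v - s) := by
    rw [Finset.sum_mul]
    exact Finset.sum_congr rfl fun i _ => by rw [hc]; ring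
  rw [h, show ∑ i, A i.castSucc (Fin.last m) * x i = ∑ i, x i * c i from hcx]
  ring

theorem posDef_hyperplane {m : ℕ} {A : Matrix (Fin (m + 1)) (Fin (m + 1)) ℝ}
    (hA : A.IsSymm) (hApos : A.PosDef) {V : Matrix (Fin m) (Fin m) ℝ}
    (hV : ∀ i j, V i j = A i.castSucc j.castSucc - A i.castSucc (Fin.last m) -
      A j.castSucc (Fin.last m) + A (Fin.last m) (Fin.last m)) :
    V.PosDef := by
  refine Matrix.PosDef.of_dotProduct_mulVec_pos ?_ fun x hx => ?_
  · ext i j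
    rw [conjTranspose_apply, star_trivial, hV, hV, hA.apply]
    ring
  · have hy : (Fin.snoc x (0 - ∑ j, x j) : Fin (m + 1) → ℝ) ≠ 0 := by
      intro h
      apply hx
      ext i
      simpa using congrFun h i.castSucc
    have h := hApos.dotProduct_mulVec_pos hy
    rw [star_trivial, dotProduct_mulVec_hyperplane hA hV (fun _ => rfl)] at h
    simpa using h

/-- Completing the square for a symmetric bilinear form. -/
theorem dotProduct_mulVec_sub_of_isSymm {n : Type*} [Fintype n] {V : Matrix n n ℝ}
    (hV : V.IsSymm) (x w : n → ℝ) :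
    (x - w) ⬝ᵥ V *ᵥ (x - w) = x ⬝ᵥ V *ᵥ x - 2 * (x ⬝ᵥ V *ᵥ w) + w ⬝ᵥ V *ᵥ w := by
  have h : w ⬝ᵥ V *ᵥ x = x ⬝ᵥ V *ᵥ w := by
    rw [dotProduct_mulVec, ← mulVec_transpose, hV.eq, dotProduct_comm]
  rw [mulVec_sub, sub_dotProduct, dotProduct_sub, dotProduct_sub, h]
  ring

/-- Equations (44)–(46): with `V`, `w`, `D` built from the blocks of a symmetric positive
definite `d × d` matrix `A` (`d = m+1 ≥ 2`) and `ν + D > 0`, the multivariate Student's `t`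
density kernel restricted to the hyperplane where the coordinates sum to `v` equals, up to
the positive constant `((ν+D)/ν)^{−(ν+d)/2}`, the Pearson type VII kernel
`(1 + (x−w)ᵀV(x−w)/(ν+D))^{−(ν+d)/2}`. -/
theorem conditional_t_is_pearsonVII
    {m : ℕ} (hm : 1 ≤ m) (v : ℝ) (ν : ℝ) (hν : 0 < ν)
    (A : Matrix (Fin (m + 1)) (Fin (m + 1)) ℝ)
    (hAsymm : A.IsSymm) (hApos : A.PosDef)
    (A₁ : Matrix (Fin m) (Fin m) ℝ) (A₂ : Fin m → ℝ) (A₃ : ℝ)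
    (hA₁ : ∀ i j, A₁ i j = A i.castSucc j.castSucc)
    (hA₂ : ∀ j, A₂ j = A j.castSucc (Fin.last m))
    (hA₃ : A₃ = A (Fin.last m) (Fin.last m))
    (V : Matrix (Fin m) (Fin m) ℝ)
    (hV : V = A₁ - vecMulVec A₂ (fun _ => 1) - vecMulVec (fun _ => 1) A₂ +
        A₃ • vecMulVec (fun _ => (1 : ℝ)) (fun _ => 1))
    (w : Fin m → ℝ)
    (hw : w = v • (V⁻¹).mulVec (A₃ • (fun _ => (1 : ℝ)) - A₂))
    (D : ℝ) (hD : D = v ^ 2 * A₃ - w ⬝ᵥ V.mulVec w)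
    (hνD : 0 < ν + D) :
    ∀ x : Fin m → ℝ,
      (1 + ((Fin.snoc x (v - ∑ j, x j)) ⬝ᵥ
            A.mulVec (Fin.snoc x (v - ∑ j, x j))) / ν) ^ (-(ν + (m + 1)) / 2) =
        ((ν + D) / ν) ^ (-(ν + (m + 1)) / 2) *
          (1 + ((x - w) ⬝ᵥ V.mulVec (x - w)) / (ν + D)) ^ (-(ν + (m + 1)) / 2) := by
  intro x
  have hVe : ∀ i j, V i j = A i.castSucc j.castSucc - A i.castSucc (Fin.last m) -
      A j.castSucc (Fin.last m) + A (Fin.last m) (Fin.last m) := by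
    intro i j
    simp [hV, hA₁, hA₂, hA₃, vecMulVec_apply]
  have hVpos := posDef_hyperplane hAsymm hApos hVe
  have hVw : V *ᵥ w = v • (A₃ • (fun _ => (1 : ℝ)) - A₂) := by
    rw [hw, mulVec_smul, mulVec_mulVec, mul_nonsing_inv _ hVpos.det_pos.ne'.isUnit, one_mulVec]
  have hsq := dotProduct_mulVec_sub_of_isSymm (isHermitian_iff_isSymm.mp hVpos.isHermitian) x w
  have hq : (Fin.snoc x (v - ∑ j, x j) : Fin (m + 1) → ℝ) ⬝ᵥ
      A *ᵥ Fin.snoc x (v - ∑ j, x j) = (x - w) ⬝ᵥ V *ᵥ (x - w) + D := by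
    rw [dotProduct_mulVec_hyperplane hAsymm hVe
      (b := A₃ • (fun _ => (1 : ℝ)) - A₂) (by simp [hA₂, hA₃]), hD, hsq, hVw, dotProduct_smul,
      hA₃, smul_eq_mul]
    ring
  have hnonneg : 0 ≤ (x - w) ⬝ᵥ V *ᵥ (x - w) := by
    simpa using hVpos.posSemidef.dotProduct_mulVec_nonneg (x - w)
  rw [hq, ← Real.mul_rpow (by positivity) (by positivity)]
  congr 1
  field_simp
  ring
end
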